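/- arXiv:2008.12508 — 5 statements merged into one kernel-verified Lean document; each statement's English description precedes it below -/
import Mathlib

section
/- Let G be a finite bipartite graph with weight function w, let M be a bottleneck assignment of G, and let e_b ∈ M be a bottleneck edge of G. If e_b has a strictly positive price of absence (in particular, removing e_b from G does not reduce the cardinality of a maximum cardinality matching and W((V, E\{e_b})) > W((V, E))), then e_b is a critical bottleneck edge of G relative to M. -/
open Finset

variable {V : Type*} [Fintype V] [DecidableEq V]

/-- `M` is a matching: no vertex is incident to more than one edge of `M`. -/
def IsMatching (M : Finset (Sym2 V)) : Prop :=
  ∀ v : V, (M.filter (fun e => v ∈ e)).card ≤ 1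

/-- `M` is a maximum cardinality matching of the graph with edge set `E`. -/
def IsMCM (E M : Finset (Sym2 V)) : Prop :=
  M ⊆ E ∧ IsMatching M ∧ ∀ M' ⊆ E, IsMatching M' → M'.card ≤ M.card

/-- The cardinality of a maximum cardinality matching of `E`. -/
noncomputable def mcmCard (E : Finset (Sym2 V)) : ℕ :=
  sSup {k : ℕ | ∃ M ⊆ E, IsMatching M ∧ M.card = k}

/-- The largest weight of an edge of `M` (`max_{e ∈ M} w(e)`). -/
noncomputable def maxW (w : Sym2 V → ℝ) (M : Finset (Sym2 V)) : ℝ :=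
  sSup (w '' (M : Set (Sym2 V)))

/-- The bottleneck weight `W(G) = min over MCMs M of max_{e ∈ M} w(e)`. -/
noncomputable def botW (w : Sym2 V → ℝ) (E : Finset (Sym2 V)) : ℝ :=
  sInf (maxW w '' {M : Finset (Sym2 V) | IsMCM E M})

/-- `M` is a bottleneck assignment of `E`. -/
def IsBotAssignment (w : Sym2 V → ℝ) (E M : Finset (Sym2 V)) : Prop :=
  IsMCM E M ∧ maxW w M = botW w E

/-- Edge `e` has strictly positive price of absence in `E`. -/
def PosPrice (w : Sym2 V → ℝ) (E : Finset (Sym2 V)) (e : Sym2 V) : Prop :=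
  mcmCard (E.erase e) < mcmCard E ∨ botW w E < botW w (E.erase e)

/-- The price of absence `P(G,e)` as an extended real (`⊤` if removing `e`
reduces the MCM cardinality). -/
noncomputable def price (w : Sym2 V → ℝ) (E : Finset (Sym2 V)) (e : Sym2 V) : EReal :=
  if mcmCard (E.erase e) < mcmCard E then ⊤
  else ((botW w (E.erase e) - botW w E : ℝ) : EReal)

/-- `E` is the edge set of a bipartite graph on disjoint parts `A` and `B`. -/
def IsBipartiteOn (A B : Finset V) (E : Finset (Sym2 V)) : Prop :=
  Disjoint A B ∧ ∀ e ∈ E, ∃ a ∈ A, ∃ b ∈ B, e = s(a, b)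

/-- `P` is a path between `x` and `y` all of whose edges lie in `E`. -/
def IsPathBetween (E P : Finset (Sym2 V)) (x y : V) : Prop :=
  ∃ (l : ℕ) (v : Fin (l + 1) → V), 0 < l ∧ Function.Injective v ∧
    v 0 = x ∧ v (Fin.last l) = y ∧
    (∀ k : Fin l, s(v k.castSucc, v k.succ) ∈ E) ∧
    P = Finset.image (fun k : Fin l => s(v k.castSucc, v k.succ)) Finset.univ

/-- `P` is alternating relative to the matching `M`. -/
def IsAlternating (M P : Finset (Sym2 V)) : Prop :=
  ∀ v : V, ((P ∩ M).filter (fun e => v ∈ e)).card ≤ 1 ∧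
    ((P \ M).filter (fun e => v ∈ e)).card ≤ 1

/-- Vertex `v` is free relative to the matching `M`. -/
def IsFree (M : Finset (Sym2 V)) (v : V) : Prop := ∀ e ∈ M, v ∉ e

/-- `P` is an augmenting path relative to `M` contained in the edge set `E`. -/
def IsAugPath (E M P : Finset (Sym2 V)) : Prop :=
  ∃ x y : V, IsPathBetween E P x y ∧ IsAlternating M P ∧ IsFree M x ∧ IsFree M y

/-- The matching-sublevel set `ψ(G,M)`. -/
noncomputable def sublevel (w : Sym2 V → ℝ) (E M : Finset (Sym2 V)) : Finset (Sym2 V) :=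
  E.filter (fun e => w e ≤ maxW w M)

/-- The strict matching-sublevel set `ψ_S(G,M)`. -/
noncomputable def strictSublevel (w : Sym2 V → ℝ) (E M : Finset (Sym2 V)) : Finset (Sym2 V) :=
  E.filter (fun e => w e < maxW w M)

/-- `ec` is a critical bottleneck edge of `E` relative to the MCM `M`. -/
noncomputable def IsCritical (w : Sym2 V → ℝ) (E M : Finset (Sym2 V)) (ec : Sym2 V) : Prop :=
  ec ∈ M ∧ (∀ e ∈ M, w e ≤ w ec) ∧
  ¬ ∃ P, IsAugPath ((M ∪ strictSublevel w E M).erase ec) (M.erase ec) P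

/-- The set `L(M)` of maximum-weight edges of `M`. -/
noncomputable def maxEdges (w : Sym2 V → ℝ) (M : Finset (Sym2 V)) : Finset (Sym2 V) :=
  M.filter (fun e => ∀ e' ∈ M, w e' ≤ w e)

/-- The edge set of the subgraph of `E` induced by agent set `Ak` and task set `Bk`. -/
def induced (E : Finset (Sym2 V)) (Ak Bk : Finset V) : Finset (Sym2 V) :=
  E.filter (fun e => ∃ a ∈ Ak, ∃ b ∈ Bk, e = s(a, b))

/-- Witness data of a solution to the SeqBAP: selected edges `{i_k, j_k}`,
vertex sets `A^k`, `B^k` (0-indexed) and bottleneck assignments `M^k` of the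
induced graphs `G^k`. -/
structure SeqBAPData (w : Sym2 V → ℝ) (A B : Finset V) (E : Finset (Sym2 V)) (n : ℕ) where
  i : Fin n → V
  j : Fin n → V
  Ak : Fin n → Finset V
  Bk : Fin n → Finset V
  Mk : Fin n → Finset (Sym2 V)
  hij : ∀ k, i k ∈ A ∧ j k ∈ B
  hedsitinct : ∀ k l, s(i k, j k) = s(i l, j l) → k = l
  hA0 : ∀ h : 0 < n, Ak ⟨0, h⟩ = A
  hB0 : ∀ h : 0 < n, Bk ⟨0, h⟩ = B
  hAk : ∀ (k : ℕ) (h : k + 1 < n),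
    Ak ⟨k + 1, h⟩ = (Ak ⟨k, by omega⟩).erase (i ⟨k, by omega⟩)
  hBk : ∀ (k : ℕ) (h : k + 1 < n),
    Bk ⟨k + 1, h⟩ = (Bk ⟨k, by omega⟩).erase (j ⟨k, by omega⟩)
  hMk : ∀ k, IsBotAssignment w (induced E (Ak k) (Bk k)) (Mk k)
  hmaxedge : ∀ k, s(i k, j k) ∈ maxEdges w (Mk k)
  hprice : ∀ k, ∀ e ∈ maxEdges w (Mk k),
    price w (induced E (Ak k) (Bk k)) e ≤ price w (induced E (Ak k) (Bk k)) (s(i k, j k))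

/-- `M` is a solution to the SeqBAP for the bipartite graph with parts `A`, `B`
and edge set `E`. -/
def IsSeqBAPSol (w : Sym2 V → ℝ) (A B : Finset V) (E M : Finset (Sym2 V)) : Prop :=
  IsMCM E M ∧ ∃ (n : ℕ) (d : SeqBAPData w A B E n),
    M.card = n ∧ M = Finset.image (fun k => s(d.i k, d.j k)) Finset.univ

/-- The weights of `M` sorted in nonincreasing order (the tuple `T(M)`). -/
noncomputable def sortedW (w : Sym2 V → ℝ) (M : Finset (Sym2 V)) : List ℝ :=
  ((M.val.map w).sort (· ≤ ·)).reverse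

/-- The `k`-th entry `T_k(M)` (0-indexed) of the sorted weight tuple. -/
noncomputable def Tk (w : Sym2 V → ℝ) (M : Finset (Sym2 V)) (k : ℕ) : ℝ :=
  (sortedW w M).getD k 0

/-- `M` is a solution to the LexBAP for the graph with edge set `E`. -/
def IsLexBAPSol (w : Sym2 V → ℝ) (E M : Finset (Sym2 V)) : Prop :=
  IsMCM E M ∧ ∀ M', IsMCM E M' → sortedW w M' ≠ sortedW w M →
    ∃ k < M.card, Tk w M k < Tk w M' k ∧ ∀ l < k, Tk w M l = Tk w M' l

lemma isMatching_iff (M : Finset (Sym2 V)) :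
    IsMatching M ↔ ∀ v : V, ∀ e ∈ M, ∀ f ∈ M, v ∈ e → v ∈ f → e = f := by
  unfold IsMatching
  simp only [Finset.card_le_one, Finset.mem_filter]
  constructor
  · intro h v e he f hf hve hvf
    exact h v e ⟨he, hve⟩ f ⟨hf, hvf⟩
  · intro h v e he f hf
    exact h v e he.1 f hf.1 he.2 hf.2

lemma alternating_count (l : ℕ) (hl : 0 < l) (b : ℕ → Prop) [DecidablePred b]
    (h0 : ¬ b 0) (hlast : ¬ b (l - 1)) (hstep : ∀ k, k + 1 < l → (b (k + 1) ↔ ¬ b k)) :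
    ((Finset.range l).filter (fun k => ¬ b k)).card
      = ((Finset.range l).filter b).card + 1 := by
  have key : ∀ n, 0 < n → n ≤ l →
      (b (n - 1) → ((Finset.range n).filter (fun k => ¬ b k)).card
        = ((Finset.range n).filter b).card) ∧
      (¬ b (n - 1) → ((Finset.range n).filter (fun k => ¬ b k)).card
        = ((Finset.range n).filter b).card + 1) := by
    intro n
    induction n with
    | zero => intro h; omega
    | succ n ih =>
      intro _ hn
      rcases Nat.eq_zero_or_pos n with rfl | hpos
      · simp [h0, Finset.filter_singleton]
      · have ih' := ih hpos (by omega)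
        have hs := hstep (n - 1) (by omega)
        have e1 : n - 1 + 1 = n := by omega
        rw [e1] at hs
        simp only [Finset.range_add_one, Finset.filter_insert, Nat.add_sub_cancel]
        by_cases hb : b n
        · have hnb := hs.1 hb
          have := ih'.2 hnb
          simp [hb, this]
        · have hnb : b (n - 1) := by
            by_contra h
            exact hb (hs.2 h)
          have := ih'.1 hnb
          simp [hb, this]
  exact (key l hl le_rfl).2 hlast

lemma augment (F M P : Finset (Sym2 V)) (hM : IsMatching M) (h : IsAugPath F M P) :
    ∃ M' : Finset (Sym2 V), M' ⊆ M ∪ F ∧ IsMatching M' ∧ M'.card = M.card + 1 := by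
  obtain ⟨x, y, ⟨l, v, hl, hinj, hx, hy, hF, hP⟩, halt, hfx, hfy⟩ := h
  obtain ⟨p, hp⟩ : ∃ p : ℕ → V, ∀ k (hk : k < l + 1), p k = v ⟨k, hk⟩ :=
    ⟨fun k => if hk : k < l + 1 then v ⟨k, hk⟩ else x, fun k hk => by simp [hk]⟩
  have pinj : ∀ i j, i ≤ l → j ≤ l → p i = p j → i = j := by
    intro i j hi hj hij
    rw [hp i (by omega), hp j (by omega)] at hij
    simpa using hinj hij
  have hp0 : p 0 = x := by rw [hp 0 (by omega), ← hx]; rfl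
  have hpl : p l = y := by rw [hp l (by omega), ← hy]; rfl
  have hPmem : ∀ e, e ∈ P ↔ ∃ k < l, e = s(p k, p (k + 1)) := by
    intro e
    rw [hP]
    simp only [Finset.mem_image, Finset.mem_univ, true_and]
    constructor
    · rintro ⟨k, rfl⟩
      refine ⟨k, k.2, ?_⟩
      rw [hp k (by omega), hp (k + 1) (by omega)]
      rfl
    · rintro ⟨k, hk, rfl⟩
      refine ⟨⟨k, hk⟩, ?_⟩
      rw [hp k (by omega), hp (k + 1) (by omega)]
      rfl
  have hPF : P ⊆ F := by
    rw [hP]; intro e he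
    simp only [Finset.mem_image, Finset.mem_univ, true_and] at he
    obtain ⟨k, rfl⟩ := he
    exact hF k
  clear hP hF hinj hp hx hy
  have einj : ∀ i j, i < l → j < l → s(p i, p (i + 1)) = s(p j, p (j + 1)) → i = j := by
    intro i j hi hj h
    rw [Sym2.eq_iff] at h
    rcases h with ⟨h, _⟩ | ⟨h1, h2⟩
    · exact pinj _ _ (by omega) (by omega) h
    · have := pinj _ _ (by omega) (by omega) h1
      have := pinj _ _ (by omega) (by omega) h2
      omega
  have hstep : ∀ k, k + 1 < l →
      (s(p (k + 1), p (k + 1 + 1)) ∈ M ↔ ¬ s(p k, p (k + 1)) ∈ M) := by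
    intro k hk
    have h1 : s(p (k + 1), p (k + 1 + 1)) ∈ P := (hPmem _).2 ⟨k + 1, hk, rfl⟩
    have h2 : s(p k, p (k + 1)) ∈ P := (hPmem _).2 ⟨k, by omega, rfl⟩
    have hne : s(p (k + 1), p (k + 1 + 1)) ≠ s(p k, p (k + 1)) := by
      intro h
      have := einj _ _ hk (by omega) h
      omega
    obtain ⟨a1, a2⟩ := halt (p (k + 1))
    rw [Finset.card_le_one] at a1 a2
    constructor
    · intro hm hm'
      exact hne (a1 _ (by simp [h1, hm]) _ (by simp [h2, hm']))
    · intro hm'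
      by_contra hm
      exact hne (a2 _ (by simp [h1, hm]) _ (by simp [h2, hm']))
  have h0 : s(p 0, p (0 + 1)) ∉ M := fun h => hfx _ h (by simp [hp0])
  have hlast : s(p (l - 1), p (l - 1 + 1)) ∉ M := fun h => hfy _ h (by
    have : l - 1 + 1 = l := by omega
    simp [this, hpl])
  have hcnt := alternating_count l hl (fun k => s(p k, p (k + 1)) ∈ M) h0 hlast hstep
  have c1 : (P \ M).card
      = ((Finset.range l).filter (fun k => ¬ s(p k, p (k + 1)) ∈ M)).card := by
    symm
    apply Finset.card_bij (fun k _ => s(p k, p (k + 1)))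
    · intro k hk
      simp only [Finset.mem_filter, Finset.mem_range] at hk
      exact Finset.mem_sdiff.2 ⟨(hPmem _).2 ⟨k, hk.1, rfl⟩, hk.2⟩
    · intro i hi j hj hij
      simp only [Finset.mem_filter, Finset.mem_range] at hi hj
      exact einj i j hi.1 hj.1 hij
    · intro e he
      rw [Finset.mem_sdiff] at he
      obtain ⟨k, hk, rfl⟩ := (hPmem e).1 he.1
      exact ⟨k, by simp [hk, he.2], rfl⟩
  have c2 : (M ∩ P).card
      = ((Finset.range l).filter (fun k => s(p k, p (k + 1)) ∈ M)).card := by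
    symm
    apply Finset.card_bij (fun k _ => s(p k, p (k + 1)))
    · intro k hk
      simp only [Finset.mem_filter, Finset.mem_range] at hk
      exact Finset.mem_inter.2 ⟨hk.2, (hPmem _).2 ⟨k, hk.1, rfl⟩⟩
    · intro i hi j hj hij
      simp only [Finset.mem_filter, Finset.mem_range] at hi hj
      exact einj i j hi.1 hj.1 hij
    · intro e he
      rw [Finset.mem_inter] at he
      obtain ⟨k, hk, rfl⟩ := (hPmem e).1 he.2
      exact ⟨k, by simp [hk, he.1], rfl⟩
  rw [isMatching_iff] at hM
  -- an `M`-edge outside `P` shares no vertex with an edge of `P`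
  have hdisj : ∀ u, ∀ e ∈ M, e ∉ P → ∀ f ∈ P, u ∈ e → u ∈ f → False := by
    intro u e he heP f hf hue huf
    obtain ⟨k, hk, rfl⟩ := (hPmem f).1 hf
    have hex : ∃ j ≤ l, u = p j := by
      rw [Sym2.mem_iff] at huf
      rcases huf with h | h
      · exact ⟨k, by omega, h⟩
      · exact ⟨k + 1, by omega, h⟩
    obtain ⟨j, hj, rfl⟩ := hex
    rcases Nat.eq_zero_or_pos j with rfl | hjpos
    · exact hfx e he (hp0 ▸ hue)
    rcases Nat.lt_or_ge j l with hjl | hjl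
    · obtain ⟨i, rfl⟩ : ∃ i, j = i + 1 := ⟨j - 1, by omega⟩
      by_cases hm : s(p i, p (i + 1)) ∈ M
      · have := hM _ e he _ hm hue (by simp)
        exact heP (this ▸ (hPmem _).2 ⟨i, by omega, rfl⟩)
      · have hm2 := (hstep i hjl).2 hm
        have := hM _ e he _ hm2 hue (by simp)
        exact heP (this ▸ (hPmem _).2 ⟨i + 1, by omega, rfl⟩)
    · have : j = l := by omega
      subst this
      exact hfy e he (hpl ▸ hue)
  refine ⟨(M \ P) ∪ (P \ M), ?_, ?_, ?_⟩
  · intro e he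
    simp only [Finset.mem_union, Finset.mem_sdiff] at he ⊢
    rcases he with he | he
    · exact Or.inl he.1
    · exact Or.inr (hPF he.1)
  · rw [isMatching_iff]
    intro u e he f hf hue huf
    simp only [Finset.mem_union, Finset.mem_sdiff] at he hf
    rcases he with he | he <;> rcases hf with hf | hf
    · exact hM u e he.1 f hf.1 hue huf
    · exact (hdisj u e he.1 he.2 f hf.1 hue huf).elim
    · exact (hdisj u f hf.1 hf.2 e he.1 huf hue).elim
    · have a2 := (halt u).2
      rw [Finset.card_le_one] at a2
      exact a2 e (by simp [he, hue]) f (by simp [hf, huf])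
  · rw [Finset.card_union_of_disjoint]
    · have := Finset.card_sdiff_add_card_inter M P
      omega
    · rw [Finset.disjoint_left]
      intro e he he'
      exact (Finset.mem_sdiff.1 he').2 (Finset.mem_sdiff.1 he).1

/-- If a bottleneck edge `e_b` of a bottleneck assignment `M` has strictly
positive price of absence (in particular, removing it does not reduce the MCM cardinality
and the bottleneck weight strictly increases), then `e_b` is a critical bottleneck edge of
`G` relative to `M`. -/
theorem bottleneck_edge_posPrice_isCritical
    (A B : Finset V) (E : Finset (Sym2 V)) (w : Sym2 V → ℝ)
    (hbip : IsBipartiteOn A B E)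
    (M : Finset (Sym2 V)) (hM : IsBotAssignment w E M)
    (eb : Sym2 V) (hebM : eb ∈ M)
    (hbot : ∀ e ∈ M, w e ≤ w eb)
    (hcard : mcmCard (E.erase eb) = mcmCard E)
    (hpos : botW w E < botW w (E.erase eb)) :
    IsCritical w E M eb := by
  refine ⟨hebM, hbot, ?_⟩
  rintro ⟨P, hP⟩
  obtain ⟨⟨hME, hMm, hMmax⟩, hMW⟩ := hM
  have hWM : maxW w M = w eb := by
    apply le_antisymm
    · refine csSup_le ⟨_, eb, hebM, rfl⟩ ?_
      rintro _ ⟨e, he, rfl⟩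
      exact hbot e he
    · exact le_csSup (M.finite_toSet.image w).bddAbove ⟨eb, hebM, rfl⟩
  have hM0 : IsMatching (M.erase eb) := by
    rw [isMatching_iff] at hMm ⊢
    intro v e he f hf
    exact hMm v e (Finset.mem_of_mem_erase he) f (Finset.mem_of_mem_erase hf)
  obtain ⟨M', hsub, hm', hc'⟩ := augment _ _ _ hM0 hP
  rw [Finset.card_erase_add_one hebM] at hc'
  have hprop : ∀ e ∈ M', e ∈ E.erase eb ∧ w e ≤ w eb := by
    intro e he
    have := hsub he
    simp only [strictSublevel, Finset.mem_union, Finset.mem_erase, Finset.mem_filter,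
      hWM] at this ⊢
    rcases this with ⟨h1, h2⟩ | ⟨h1, h2 | ⟨h2, h3⟩⟩
    · exact ⟨⟨h1, hME h2⟩, hbot e h2⟩
    · exact ⟨⟨h1, hME h2⟩, hbot e h2⟩
    · exact ⟨⟨h1, h2⟩, h3.le⟩
  have hMCM : IsMCM (E.erase eb) M' := by
    refine ⟨fun e he => (hprop e he).1, hm', fun N hN hNm => ?_⟩
    rw [hc']
    exact hMmax N (hN.trans (Finset.erase_subset _ _)) hNm
  have hne : M'.Nonempty := by
    rw [← Finset.card_pos, hc']
    exact Finset.card_pos.2 ⟨eb, hebM⟩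
  have h1 : maxW w M' ≤ w eb := by
    obtain ⟨e0, he0⟩ := hne
    refine csSup_le ⟨_, e0, he0, rfl⟩ ?_
    rintro _ ⟨e, he, rfl⟩
    exact (hprop e he).2
  have h2 : botW w (E.erase eb) ≤ maxW w M' :=
    csInf_le ((Set.toFinite _).image _).bddBelow ⟨M', hMCM, rfl⟩
  linarith
end

section
/- Let G = (V, E) be a finite bipartite graph with weight function w. If an edge e_p ∈ E has a strictly positive price of absence, then e_p is an element of every bottleneck assignment of G, i.e., for every MCM M of G with max_{e ∈ M} w(e) = W(G), one has e_p ∈ M. -/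
open Finset

variable {V : Type*} [Fintype V] [DecidableEq V]

/-- An edge with strictly positive price of absence belongs to every
bottleneck assignment of `G`. -/
theorem posPrice_mem_every_bottleneck_assignment
    (A B : Finset V) (E : Finset (Sym2 V)) (w : Sym2 V → ℝ)
    (hbip : IsBipartiteOn A B E)
    (ep : Sym2 V) (hep : ep ∈ E) (hpos : PosPrice w E ep) :
    ∀ M : Finset (Sym2 V), IsBotAssignment w E M → ep ∈ M := by
  intro M hM
  obtain ⟨⟨hME, hMm, hMmax⟩, hMw⟩ := hM
  by_contra hne
  have hsub : M ⊆ E.erase ep := Finset.subset_erase.mpr ⟨hME, hne⟩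
  rcases hpos with h | h
  · have h1 : mcmCard E ≤ M.card := by
      refine csSup_le (Set.nonempty_of_mem (x := M.card) ⟨M, hME, hMm, rfl⟩) ?_
      rintro k ⟨M', hM', hm, rfl⟩
      exact hMmax M' hM' hm
    have h2 : M.card ≤ mcmCard (E.erase ep) := by
      apply le_csSup
      · refine ⟨E.card, ?_⟩
        rintro k ⟨M', hM', _, rfl⟩
        exact Finset.card_le_card (hM'.trans (Finset.erase_subset _ _))
      · exact ⟨M, hsub, hMm, rfl⟩
    omega
  · have h2 : botW w (E.erase ep) ≤ maxW w M := by
      apply csInf_le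
      · exact ((Set.toFinite _).image _).bddBelow
      · exact ⟨M, ⟨hsub, hMm, fun M' hM' hm =>
          hMmax M' (hM'.trans (Finset.erase_subset _ _)) hm⟩, rfl⟩
    linarith
end

section
/- Let G be a finite bipartite graph with weight function w and let M be an MCM of G. If M is a solution to the SeqBAP for G, then M is a solution to the BAP for G, i.e., M is a bottleneck assignment of G. -/
open Finset

variable {V : Type*} [Fintype V] [DecidableEq V]

theorem botW_le_aux (w : Sym2 V → ℝ) (E M : Finset (Sym2 V)) (h : IsMCM E M) :
    botW w E ≤ maxW w M := by
  apply csInf_le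
  · exact (Set.Finite.image _ (Set.toFinite _)).bddBelow
  · exact ⟨M, h, rfl⟩

theorem le_maxW_aux (w : Sym2 V → ℝ) (M : Finset (Sym2 V)) (e : Sym2 V) (h : e ∈ M) :
    w e ≤ maxW w M := by
  apply le_csSup
  · exact (Set.Finite.image _ (Set.toFinite _)).bddAbove
  · exact ⟨e, h, rfl⟩

theorem maxW_le_aux (w : Sym2 V → ℝ) (M : Finset (Sym2 V)) (c : ℝ) (hM : M.Nonempty)
    (h : ∀ e ∈ M, w e ≤ c) : maxW w M ≤ c := by
  apply csSup_le
  · obtain ⟨e, he⟩ := hM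
    exact ⟨w e, e, he, rfl⟩
  · rintro _ ⟨e, he, rfl⟩
    exact h e he

theorem maxEdges_aux (w : Sym2 V → ℝ) (M : Finset (Sym2 V)) (e : Sym2 V)
    (h : e ∈ maxEdges w M) : w e = maxW w M := by
  simp only [maxEdges, Finset.mem_filter] at h
  exact le_antisymm (le_maxW_aux w M e h.1) (maxW_le_aux w M _ ⟨e, h.1⟩ h.2)

theorem matching_eq_aux {M : Finset (Sym2 V)} (h : IsMatching M) {v : V} {e f : Sym2 V}
    (he : e ∈ M) (hf : f ∈ M) (hve : v ∈ e) (hvf : v ∈ f) : e = f :=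
  Finset.card_le_one.1 (h v) e (by simp [he, hve]) f (by simp [hf, hvf])

theorem step_aux (E : Finset (Sym2 V)) (A B : Finset V) (i j : V)
    (hi : i ∈ A) (hj : j ∈ B)
    (hdisj : Disjoint A B) (M : Finset (Sym2 V))
    (hM : IsMCM (induced E A B) M) (he : s(i, j) ∈ M) :
    IsMCM (induced E (A.erase i) (B.erase j)) (M.erase s(i, j)) := by
  obtain ⟨hsub, hmat, hmax⟩ := hM
  have hsub' : induced E (A.erase i) (B.erase j) ⊆ induced E A B := by
    intro e h
    simp only [induced, Finset.mem_filter] at h ⊢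
    obtain ⟨h1, a, ha, b, hb, h2⟩ := h
    exact ⟨h1, a, Finset.mem_of_mem_erase ha, b, Finset.mem_of_mem_erase hb, h2⟩
  have hav : ∀ f ∈ induced E (A.erase i) (B.erase j), i ∉ f ∧ j ∉ f := by
    intro f h
    simp only [induced, Finset.mem_filter] at h
    obtain ⟨h1, a, ha, b, hb, rfl⟩ := h
    have hd := Finset.disjoint_left.1 hdisj
    simp only [Finset.mem_erase] at ha hb
    simp only [Sym2.mem_iff, not_or]
    refine ⟨⟨fun h => ha.1 h.symm, ?_⟩, ?_, fun h => hb.1 h.symm⟩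
    · rintro rfl
      exact hd hi hb.2
    · rintro rfl
      exact hd ha.2 hj
  refine ⟨?_, ?_, ?_⟩
  · intro f hf
    rw [Finset.mem_erase] at hf
    have h := hsub hf.2
    simp only [induced, Finset.mem_filter] at h ⊢
    obtain ⟨h1, a, ha, b, hb, rfl⟩ := h
    refine ⟨h1, a, Finset.mem_erase.2 ⟨?_, ha⟩, b, Finset.mem_erase.2 ⟨?_, hb⟩, rfl⟩
    · rintro rfl
      exact hf.1 (matching_eq_aux hmat (v := a) hf.2 he (by simp) (by simp))
    · rintro rfl
      exact hf.1 (matching_eq_aux hmat (v := b) hf.2 he (by simp) (by simp))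
  · intro v
    exact (Finset.card_le_card
      (Finset.filter_subset_filter _ (Finset.erase_subset _ _))).trans (hmat v)
  · intro M' hM' hm'
    have hnot : s(i, j) ∉ M' := fun h => (hav _ (hM' h)).1 (by simp)
    have := hmax (insert s(i, j) M') ?_ ?_
    · rw [Finset.card_insert_of_notMem hnot] at this
      rw [Finset.card_erase_of_mem he]
      omega
    · intro f hf
      rcases Finset.mem_insert.1 hf with rfl | hf
      · exact hsub he
      · exact hsub' (hM' hf)
    · intro v
      rw [Finset.card_le_one]
      have key : ∀ f ∈ M', v ∈ s(i, j) → v ∉ f := by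
        intro f hf hv
        rcases Sym2.mem_iff.1 hv with rfl | rfl
        · exact (hav _ (hM' hf)).1
        · exact (hav _ (hM' hf)).2
      intro a ha b hb
      simp only [Finset.mem_filter, Finset.mem_insert] at ha hb
      obtain ⟨rfl | ha, hva⟩ := ha
      · obtain ⟨rfl | hb, hvb⟩ := hb
        · rfl
        · exact absurd hvb (key _ hb hva)
      · obtain ⟨rfl | hb, hvb⟩ := hb
        · exact absurd hva (key _ ha hvb)
        · exact matching_eq_aux hm' ha hb hva hvb

/-- Every solution to the SeqBAP is a solution to the BAP, i.e., a
bottleneck assignment of `G`. -/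
theorem seqBAP_sol_is_bottleneck_assignment
    (A B : Finset V) (E : Finset (Sym2 V)) (w : Sym2 V → ℝ)
    (hbip : IsBipartiteOn A B E)
    (M : Finset (Sym2 V)) (hseq : IsSeqBAPSol w A B E M) :
    IsBotAssignment w E M := by
  obtain ⟨hmcm, n, d, hcard, hM⟩ := hseq
  obtain ⟨hdisj, hE⟩ := hbip
  refine ⟨hmcm, le_antisymm ?_ (botW_le_aux w E M hmcm)⟩
  rcases Nat.eq_zero_or_pos n with h0 | hn
  · subst h0
    have hMe : M = ∅ := Finset.card_eq_zero.1 hcard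
    apply le_csInf
    · exact ⟨_, M, hmcm, rfl⟩
    · rintro _ ⟨M', hM', rfl⟩
      have h1 := hmcm.2.2 M' hM'.1 hM'.2.1
      have h2 : M' = ∅ := Finset.card_eq_zero.1 (by omega)
      rw [hMe, h2]
  have hind : induced E A B = E := by
    apply Finset.filter_true_of_mem
    exact hE
  have hsubs : ∀ (k : ℕ) (h : k < n), d.Ak ⟨k, h⟩ ⊆ A ∧ d.Bk ⟨k, h⟩ ⊆ B := by
    intro k
    induction k with
    | zero => intro h; rw [d.hA0 h, d.hB0 h]; exact ⟨subset_rfl, subset_rfl⟩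
    | succ k ih =>
      intro h
      have := ih (by omega)
      rw [d.hAk k h, d.hBk k h]
      exact ⟨(Finset.erase_subset _ _).trans this.1, (Finset.erase_subset _ _).trans this.2⟩
  have hin : ∀ k, s(d.i k, d.j k) ∈ d.Mk k := fun k => (Finset.mem_filter.1 (d.hmaxedge k)).1
  have hmem : ∀ (k : Fin n), d.i k ∈ d.Ak k ∧ d.j k ∈ d.Bk k := by
    intro k
    have h := (d.hMk k).1.1 (hin k)
    simp only [induced, Finset.mem_filter] at h
    obtain ⟨-, a, ha, b, hb, hab⟩ := h
    have hs := hsubs k k.2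
    rcases Sym2.eq_iff.1 hab with ⟨h1, h2⟩ | ⟨h1, h2⟩
    · rw [h1, h2]; exact ⟨ha, hb⟩
    · exact absurd (hs.2 hb) (Finset.disjoint_left.1 hdisj (h1 ▸ (d.hij k).1))
  have hdec : ∀ (k : ℕ) (h : k < n), maxW w (d.Mk ⟨k, h⟩) ≤ botW w E := by
    intro k
    induction k with
    | zero =>
      intro h
      have := (d.hMk ⟨0, h⟩).2
      rw [d.hA0 h, d.hB0 h, hind] at this
      exact this.le
    | succ k ih =>
      intro h
      have hk : k < n := by omega
      refine le_trans ?_ (ih hk)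
      have hs := hsubs k hk
      have hst := step_aux E _ _ _ _ (hmem ⟨k, hk⟩).1 (hmem ⟨k, hk⟩).2
        (Finset.disjoint_of_subset_left hs.1 (Finset.disjoint_of_subset_right hs.2 hdisj))
        _ (d.hMk ⟨k, hk⟩).1 (hin _)
      have hb := d.hMk ⟨k + 1, h⟩
      rw [d.hAk k h, d.hBk k h] at hb
      rw [hb.2]
      refine (botW_le_aux w _ _ hst).trans (maxW_le_aux w _ _ ?_ ?_)
      · have h1 := hst.2.2 _ hb.1.1 hb.1.2.1
        have h2 := Finset.card_pos.2 ⟨_, hin ⟨k + 1, h⟩⟩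
        exact Finset.card_pos.1 (by omega)
      · intro e he
        exact le_maxW_aux w _ e (Finset.mem_of_mem_erase he)
  apply maxW_le_aux
  · exact Finset.card_pos.1 (by omega)
  · intro e he
    rw [hM] at he
    obtain ⟨k, -, rfl⟩ := Finset.mem_image.1 he
    rw [maxEdges_aux w _ _ (d.hmaxedge k)]
    exact hdec k k.2
end

section
/- Let G be a finite bipartite graph with weight function w and let M = {{i_1,j_1},...,{i_n,j_n}} be a solution to the SeqBAP for G, with associated graphs G^k. Then every sequentially selected edge {i_k,j_k} has strictly positive price of absence in its respective graph G^k for all k ∈ {1,...,n} if and only if M is the unique solution to the SeqBAP for G. -/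
open Finset

variable {V : Type*} [Fintype V] [DecidableEq V]

theorem aux_matching_iff {M : Finset (Sym2 V)} :
    IsMatching M ↔ ∀ e ∈ M, ∀ f ∈ M, ∀ v : V, v ∈ e → v ∈ f → e = f := by
  unfold IsMatching
  constructor
  · intro h e he f hf v hve hvf
    exact Finset.card_le_one.1 (h v) e (by simp [he, hve]) f (by simp [hf, hvf])
  · intro h v
    rw [Finset.card_le_one]
    intro e he f hf
    simp only [Finset.mem_filter] at he hf
    exact h e he.1 f hf.1 v he.2 hf.2

theorem aux_mem_del {A B : Finset V} (hAB : Disjoint A B) (E : Finset (Sym2 V)) {a b : V}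
    (ha : a ∈ A) (hb : b ∈ B) (x : Sym2 V) :
    x ∈ induced E (A.erase a) (B.erase b) ↔ x ∈ induced E A B ∧ a ∉ x ∧ b ∉ x := by
  have hd := Finset.disjoint_left.1 hAB
  unfold induced
  simp only [Finset.mem_filter, Finset.mem_erase]
  constructor
  · rintro ⟨hx, a', ⟨h1, h2⟩, b', ⟨h3, h4⟩, rfl⟩
    refine ⟨⟨hx, a', h2, b', h4, rfl⟩, ?_, ?_⟩
    · rw [Sym2.mem_iff]
      rintro (h | h)
      · exact h1 h.symm
      · exact hd ha (h ▸ h4)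
    · rw [Sym2.mem_iff]
      rintro (h | h)
      · exact hd h2 (h ▸ hb)
      · exact h3 h.symm
  · rintro ⟨⟨hx, a', h2, b', h4, rfl⟩, h5, h6⟩
    rw [Sym2.mem_iff] at h5 h6
    push Not at h5 h6
    exact ⟨hx, a', ⟨h5.1.symm, h2⟩, b', ⟨h6.2.symm, h4⟩, rfl⟩

theorem aux_matching_insert {N : Finset (Sym2 V)} {a b : V} (hN : IsMatching N)
    (h : ∀ x ∈ N, a ∉ x ∧ b ∉ x) : IsMatching (insert s(a, b) N) := by
  rw [aux_matching_iff] at *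
  intro e he f hf v hve hvf
  rw [Finset.mem_insert] at he hf
  rcases he with rfl | he <;> rcases hf with rfl | hf
  · rfl
  · rw [Sym2.mem_iff] at hve
    rcases hve with rfl | rfl
    · exact absurd hvf (h f hf).1
    · exact absurd hvf (h f hf).2
  · rw [Sym2.mem_iff] at hvf
    rcases hvf with rfl | rfl
    · exact absurd hve (h e he).1
    · exact absurd hve (h e he).2
  · exact hN e he f hf v hve hvf

theorem aux_matching_mono {N M : Finset (Sym2 V)} (hM : IsMatching M) (h : N ⊆ M) :
    IsMatching N := by
  rw [aux_matching_iff] at *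
  exact fun e he f hf => hM e (h he) f (h hf)

theorem aux_exists_mcm (E : Finset (Sym2 V)) : ∃ M, IsMCM E M := by
  classical
  obtain ⟨M, hM, hmax⟩ := Finset.exists_max_image (E.powerset.filter IsMatching) Finset.card
    ⟨∅, by simp [IsMatching]⟩
  simp only [Finset.mem_filter, Finset.mem_powerset] at hM hmax
  exact ⟨M, hM.1, hM.2, fun M' h1 h2 => hmax M' ⟨h1, h2⟩⟩

theorem aux_mcmCard {E M : Finset (Sym2 V)} (h : IsMCM E M) : mcmCard E = M.card := by
  refine IsGreatest.csSup_eq ⟨⟨M, h.1, h.2.1, rfl⟩, ?_⟩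
  rintro k ⟨N, h1, h2, rfl⟩
  exact h.2.2 N h1 h2

theorem aux_card_eq {E M N : Finset (Sym2 V)} (h : IsMCM E M) (h' : IsMCM E N) :
    M.card = N.card := by
  rw [← aux_mcmCard h, ← aux_mcmCard h']

theorem aux_mcm_of_card {E M N : Finset (Sym2 V)} (h : IsMCM E M) (h1 : N ⊆ E)
    (h2 : IsMatching N) (h3 : M.card ≤ N.card) : IsMCM E N :=
  ⟨h1, h2, fun M' h4 h5 => (h.2.2 M' h4 h5).trans h3⟩

/-- removing a matched edge -/
theorem aux_mcm_erase {A B : Finset V} (hAB : Disjoint A B) {E M : Finset (Sym2 V)} {a b : V}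
    (ha : a ∈ A) (hb : b ∈ B) (hM : IsMCM (induced E A B) M) (he : s(a, b) ∈ M) :
    IsMCM (induced E (A.erase a) (B.erase b)) (M.erase s(a, b)) := by
  have hmat := aux_matching_iff.1 hM.2.1
  refine ⟨?_, aux_matching_mono hM.2.1 (Finset.erase_subset _ _), ?_⟩
  · intro x hx
    rw [Finset.mem_erase] at hx
    rw [aux_mem_del hAB E ha hb]
    exact ⟨hM.1 hx.2, fun h => hx.1 (hmat x hx.2 _ he a h (by simp)),
      fun h => hx.1 (hmat x hx.2 _ he b h (by simp))⟩
  · intro N hN hNm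
    have hN' : ∀ x ∈ N, x ∈ induced E A B ∧ a ∉ x ∧ b ∉ x := fun x hx =>
      (aux_mem_del hAB E ha hb x).1 (hN hx)
    have h1 : s(a, b) ∉ N := fun h => (hN' _ h).2.1 (by simp)
    have := hM.2.2 (insert s(a, b) N)
      (Finset.insert_subset (hM.1 he) (fun x hx => (hN' x hx).1))
      (aux_matching_insert hNm (fun x hx => (hN' x hx).2))
    rw [Finset.card_insert_of_notMem h1] at this
    rw [Finset.card_erase_of_mem he]
    omega

theorem aux_notMem_del {A B : Finset V} (hAB : Disjoint A B) {E N : Finset (Sym2 V)} {a b : V}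
    (ha : a ∈ A) (hb : b ∈ B) (hN : N ⊆ induced E (A.erase a) (B.erase b)) :
    s(a, b) ∉ N := fun h => ((aux_mem_del hAB E ha hb _).1 (hN h)).2.1 (by simp)

/-- adding an edge back -/
theorem aux_mcm_insert {A B : Finset V} (hAB : Disjoint A B) {E M N : Finset (Sym2 V)} {a b : V}
    (ha : a ∈ A) (hb : b ∈ B) (hM : IsMCM (induced E A B) M) (he : s(a, b) ∈ M)
    (hN : IsMCM (induced E (A.erase a) (B.erase b)) N) :
    IsMCM (induced E A B) (insert s(a, b) N) := by
  have hN' : ∀ x ∈ N, x ∈ induced E A B ∧ a ∉ x ∧ b ∉ x := fun x hx =>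
      (aux_mem_del hAB E ha hb x).1 (hN.1 hx)
  have h1 := aux_notMem_del hAB ha hb hN.1
  refine aux_mcm_of_card hM (Finset.insert_subset (hM.1 he) (fun x hx => (hN' x hx).1))
    (aux_matching_insert hN.2.1 (fun x hx => (hN' x hx).2)) ?_
  have := aux_card_eq hN (aux_mcm_erase hAB ha hb hM he)
  rw [Finset.card_erase_of_mem he] at this
  rw [Finset.card_insert_of_notMem h1]
  omega

theorem aux_le_maxW (w : Sym2 V → ℝ) {M : Finset (Sym2 V)} {e : Sym2 V} (he : e ∈ M) :
    w e ≤ maxW w M :=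
  le_csSup ((M.finite_toSet.image w).bddAbove) ⟨e, he, rfl⟩

theorem aux_exists_maxW (w : Sym2 V → ℝ) {M : Finset (Sym2 V)} (hM : M.Nonempty) :
    ∃ e ∈ M, w e = maxW w M := by
  have : (w '' (M : Set (Sym2 V))).Nonempty := ⟨_, hM.choose, hM.choose_spec, rfl⟩
  obtain ⟨e, he, h⟩ := this.csSup_mem (M.finite_toSet.image w)
  exact ⟨e, he, h⟩

theorem aux_botW_le (w : Sym2 V → ℝ) {E M : Finset (Sym2 V)} (hM : IsMCM E M) :
    botW w E ≤ maxW w M :=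
  csInf_le ((Set.toFinite _).image _).bddBelow ⟨M, hM, rfl⟩

theorem aux_exists_bot (w : Sym2 V → ℝ) (E : Finset (Sym2 V)) : ∃ M, IsBotAssignment w E M := by
  have : (maxW w '' {M : Finset (Sym2 V) | IsMCM E M}).Nonempty :=
    (aux_exists_mcm E).elim fun M hM => ⟨_, M, hM, rfl⟩
  obtain ⟨M, hM, h⟩ := this.csInf_mem ((Set.toFinite _).image _)
  exact ⟨M, hM, h⟩

theorem aux_posPrice_iff (w : Sym2 V → ℝ) (E : Finset (Sym2 V)) (e : Sym2 V) :
    PosPrice w E e ↔ ∀ N, IsBotAssignment w E N → e ∈ N := by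
  constructor
  · intro h N hN
    by_contra he
    have hsub : N ⊆ E.erase e := fun x hx =>
      Finset.mem_erase.2 ⟨fun h' => he (h' ▸ hx), hN.1.1 hx⟩
    have hN' : IsMCM (E.erase e) N := ⟨hsub, hN.1.2.1, fun M' h1 h2 =>
      hN.1.2.2 M' (h1.trans (Finset.erase_subset _ _)) h2⟩
    have h1 := aux_mcmCard hN.1
    have h2 := aux_mcmCard hN'
    have h3 := aux_botW_le w hN'
    have h4 := hN.2
    rcases h with h | h
    · omega
    · linarith
  · intro h
    by_contra hp
    unfold PosPrice at hp
    push Not at hp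
    obtain ⟨N, hN⟩ := aux_exists_bot w (E.erase e)
    obtain ⟨M, hM⟩ := aux_exists_mcm E
    have h1 := aux_mcmCard hN.1
    have h2 := aux_mcmCard hM
    have hN' : IsMCM E N := aux_mcm_of_card hM (hN.1.1.trans (Finset.erase_subset _ _))
      hN.1.2.1 (by omega)
    have h3 := aux_botW_le w hN'
    have := h N ⟨hN', by have := hN.2; have := hp.2; linarith⟩
    exact (Finset.mem_erase.1 (hN.1.1 this)).1 rfl

theorem aux_price_pos_iff (w : Sym2 V → ℝ) (E : Finset (Sym2 V)) (e : Sym2 V) :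
    0 < price w E e ↔ PosPrice w E e := by
  unfold price PosPrice
  split_ifs with h
  · simp [h]
  · rw [EReal.coe_pos, sub_pos]
    simp [h]

theorem aux_mem_maxEdges {w : Sym2 V → ℝ} {M : Finset (Sym2 V)} {e : Sym2 V} :
    e ∈ maxEdges w M ↔ e ∈ M ∧ w e = maxW w M := by
  unfold maxEdges
  rw [Finset.mem_filter]
  constructor
  · rintro ⟨h1, h2⟩
    obtain ⟨f, hf, hf'⟩ := aux_exists_maxW w ⟨e, h1⟩
    exact ⟨h1, le_antisymm (aux_le_maxW w h1) (hf' ▸ h2 f hf)⟩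
  · rintro ⟨h1, h2⟩
    exact ⟨h1, fun e' he' => h2 ▸ aux_le_maxW w he'⟩

/-- the selected edges -/
def SeqBAPData.img {w : Sym2 V → ℝ} {A B : Finset V} {E : Finset (Sym2 V)} {n : ℕ}
    (d : SeqBAPData w A B E n) : Finset (Sym2 V) :=
  Finset.image (fun k => s(d.i k, d.j k)) Finset.univ

theorem SeqBAPData.Ak_subset {w : Sym2 V → ℝ} {A B : Finset V} {E : Finset (Sym2 V)} {n : ℕ}
    (d : SeqBAPData w A B E n) : ∀ (k : ℕ) (h : k < n), d.Ak ⟨k, h⟩ ⊆ A ∧ d.Bk ⟨k, h⟩ ⊆ B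
  | 0, h => by rw [d.hA0, d.hB0]; exact ⟨subset_rfl, subset_rfl⟩
  | k + 1, h => by
    rw [d.hAk, d.hBk]
    have := d.Ak_subset k (by omega)
    exact ⟨(Finset.erase_subset _ _).trans this.1, (Finset.erase_subset _ _).trans this.2⟩

theorem SeqBAPData.mem_Ak {w : Sym2 V → ℝ} {A B : Finset V} {E : Finset (Sym2 V)} {n : ℕ}
    (hAB : Disjoint A B) (d : SeqBAPData w A B E n) (k : Fin n) :
    d.i k ∈ d.Ak k ∧ d.j k ∈ d.Bk k := by
  have hd := Finset.disjoint_left.1 hAB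
  have h1 := (d.hMk k).1.1 (aux_mem_maxEdges.1 (d.hmaxedge k)).1
  have hs := d.Ak_subset k.1 k.2
  unfold induced at h1
  rw [Finset.mem_filter] at h1
  obtain ⟨-, a, ha, b, hb, h⟩ := h1
  rw [Sym2.eq_iff] at h
  rcases h with ⟨h2, h3⟩ | ⟨h2, h3⟩
  · exact ⟨h2 ▸ ha, h3 ▸ hb⟩
  · exact absurd (h2 ▸ hs.2 hb) (hd (d.hij k).1)

theorem SeqBAPData.Ak_succ_subset {w : Sym2 V → ℝ} {A B : Finset V} {E : Finset (Sym2 V)} {n : ℕ}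
    (d : SeqBAPData w A B E (n + 1)) : ∀ (k : ℕ) (h : k + 1 < n + 1),
    d.Ak ⟨k + 1, h⟩ ⊆ A.erase (d.i 0) ∧ d.Bk ⟨k + 1, h⟩ ⊆ B.erase (d.j 0)
  | 0, h => by
    rw [d.hAk, d.hBk, d.hA0, d.hB0]
    exact ⟨subset_rfl, subset_rfl⟩
  | k + 1, h => by
    rw [d.hAk, d.hBk]
    have := d.Ak_succ_subset k (by omega)
    exact ⟨(Finset.erase_subset _ _).trans this.1, (Finset.erase_subset _ _).trans this.2⟩

/-- drop the first selected edge -/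
def SeqBAPData.tail {w : Sym2 V → ℝ} {A B : Finset V} {E : Finset (Sym2 V)} {n : ℕ}
    (hAB : Disjoint A B) (d : SeqBAPData w A B E (n + 1)) :
    SeqBAPData w (A.erase (d.i 0)) (B.erase (d.j 0)) E n where
  i k := d.i k.succ
  j k := d.j k.succ
  Ak k := d.Ak k.succ
  Bk k := d.Bk k.succ
  Mk k := d.Mk k.succ
  hij k := ⟨(d.Ak_succ_subset k.1 _).1 (d.mem_Ak hAB k.succ).1,
    (d.Ak_succ_subset k.1 _).2 (d.mem_Ak hAB k.succ).2⟩
  hedsitinct k l h := Fin.succ_injective _ (d.hedsitinct _ _ h)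
  hA0 h := by
    have := d.hAk 0 (by omega)
    rw [d.hA0] at this
    exact this
  hB0 h := by
    have := d.hBk 0 (by omega)
    rw [d.hB0] at this
    exact this
  hAk k h := d.hAk (k + 1) (by omega)
  hBk k h := d.hBk (k + 1) (by omega)
  hMk k := d.hMk k.succ
  hmaxedge k := d.hmaxedge k.succ
  hprice k := d.hprice k.succ

theorem SeqBAPData.img_tail {w : Sym2 V → ℝ} {A B : Finset V} {E : Finset (Sym2 V)} {n : ℕ}
    (hAB : Disjoint A B) (d : SeqBAPData w A B E (n + 1)) :
    d.img = insert s(d.i 0, d.j 0) (d.tail hAB).img ∧ s(d.i 0, d.j 0) ∉ (d.tail hAB).img := by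
  constructor
  · ext x
    simp only [img, Finset.mem_image, Finset.mem_univ, true_and, Finset.mem_insert,
      Fin.exists_fin_succ, tail]
    simp only [eq_comm]
  · simp only [img, Finset.mem_image, Finset.mem_univ, true_and, tail]
    rintro ⟨k, hk⟩
    exact absurd (d.hedsitinct _ _ hk) (Fin.succ_ne_zero k)

/-- prepend a selected edge -/
def SeqBAPData.cons {w : Sym2 V → ℝ} {A B : Finset V} {E : Finset (Sym2 V)} {n : ℕ}
    (hAB : Disjoint A B) {a b : V} (ha : a ∈ A) (hb : b ∈ B) (M₀ : Finset (Sym2 V))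
    (hM : IsBotAssignment w (induced E A B) M₀) (hmax : s(a, b) ∈ maxEdges w M₀)
    (hpr : ∀ e ∈ maxEdges w M₀, price w (induced E A B) e ≤ price w (induced E A B) s(a, b))
    (d : SeqBAPData w (A.erase a) (B.erase b) E n) : SeqBAPData w A B E (n + 1) where
  i := Fin.cons a d.i
  j := Fin.cons b d.j
  Ak := Fin.cons A d.Ak
  Bk := Fin.cons B d.Bk
  Mk := Fin.cons M₀ d.Mk
  hij k := by
    refine Fin.cases ⟨ha, hb⟩ (fun k => ?_) k
    exact ⟨Finset.mem_of_mem_erase (d.hij k).1, Finset.mem_of_mem_erase (d.hij k).2⟩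
  hedsitinct k l := by
    have key : ∀ k, s(a, b) ≠ s(d.i k, d.j k) := by
      intro k h
      have h1 := Finset.mem_erase.1 (d.hij k).1
      have h2 := Finset.mem_erase.1 (d.hij k).2
      rw [Sym2.eq_iff] at h
      rcases h with ⟨h, -⟩ | ⟨h, -⟩
      · exact h1.1 h.symm
      · exact Finset.disjoint_left.1 hAB ha (h ▸ h2.2)
    refine Fin.cases ?_ (fun k => ?_) k <;> refine Fin.cases ?_ (fun l => ?_) l
    · intro; rfl
    · intro h; exact absurd h (key l)
    · intro h; exact absurd h.symm (key k)
    · intro h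
      exact congrArg Fin.succ (d.hedsitinct k l h)
  hA0 h := rfl
  hB0 h := rfl
  hAk k h := by
    cases k with
    | zero => exact d.hA0 (by omega)
    | succ k => exact d.hAk k (by omega)
  hBk k h := by
    cases k with
    | zero => exact d.hB0 (by omega)
    | succ k => exact d.hBk k (by omega)
  hMk k := Fin.cases hM (fun k => d.hMk k) k
  hmaxedge k := Fin.cases hmax (fun k => d.hmaxedge k) k
  hprice k := Fin.cases hpr (fun k => d.hprice k) k

theorem SeqBAPData.img_cons {w : Sym2 V → ℝ} {A B : Finset V} {E : Finset (Sym2 V)} {n : ℕ}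
    (hAB : Disjoint A B) {a b : V} (ha : a ∈ A) (hb : b ∈ B) (M₀ : Finset (Sym2 V))
    (hM : IsBotAssignment w (induced E A B) M₀) (hmax : s(a, b) ∈ maxEdges w M₀)
    (hpr : ∀ e ∈ maxEdges w M₀, price w (induced E A B) e ≤ price w (induced E A B) s(a, b))
    (d : SeqBAPData w (A.erase a) (B.erase b) E n) :
    (SeqBAPData.cons hAB ha hb M₀ hM hmax hpr d).img = insert s(a, b) d.img := by
  ext x
  simp only [img, Finset.mem_image, Finset.mem_univ, true_and, Finset.mem_insert,
    Fin.exists_fin_succ, cons, Fin.cons_zero, Fin.cons_succ]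
  simp only [eq_comm]

/-- first step facts -/
theorem SeqBAPData.first {w : Sym2 V → ℝ} {A B : Finset V} {E : Finset (Sym2 V)} {n : ℕ}
    (d : SeqBAPData w A B E (n + 1)) :
    IsBotAssignment w (induced E A B) (d.Mk 0) ∧ s(d.i 0, d.j 0) ∈ maxEdges w (d.Mk 0) ∧
    ∀ e ∈ maxEdges w (d.Mk 0),
      price w (induced E A B) e ≤ price w (induced E A B) s(d.i 0, d.j 0) := by
  have h1 := d.hMk 0
  have h2 := d.hprice 0
  have h3 : d.Ak 0 = A := d.hA0 (by omega)
  have h4 : d.Bk 0 = B := d.hB0 (by omega)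
  rw [h3, h4] at h1 h2
  exact ⟨h1, d.hmaxedge 0, h2⟩

theorem aux_disj_erase {A B : Finset V} (hAB : Disjoint A B) (a b : V) :
    Disjoint (A.erase a) (B.erase b) :=
  hAB.mono (Finset.erase_subset _ _) (Finset.erase_subset _ _)

theorem aux_weight_le {w : Sym2 V → ℝ} {E : Finset (Sym2 V)} : ∀ {n : ℕ} {A B : Finset V}
    (_ : Disjoint A B) (d : SeqBAPData w A B E n) (N : Finset (Sym2 V)),
    IsMCM (induced E A B) N → ∀ x ∈ d.img, ∃ y ∈ N, w x ≤ w y := by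
  intro n
  induction n with
  | zero =>
    intro A B _ d N _ x hx
    simp [SeqBAPData.img] at hx
  | succ n ih =>
    intro A B hAB d N hN x hx
    obtain ⟨hb, hm, -⟩ := d.first
    rw [aux_mem_maxEdges] at hm
    have hNe : N.Nonempty := by
      rw [← Finset.card_pos, aux_card_eq hN hb.1, Finset.card_pos]
      exact ⟨_, hm.1⟩
    obtain ⟨y, hy, hy'⟩ := aux_exists_maxW w hNe
    refine ⟨y, hy, ?_⟩
    have h1 := aux_botW_le w hN
    have h2 := hb.2
    rw [(d.img_tail hAB).1, Finset.mem_insert] at hx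
    rcases hx with rfl | hx
    · linarith [hm.2]
    · obtain ⟨z, hz, hz'⟩ := ih (aux_disj_erase hAB _ _) (d.tail hAB) _
        (aux_mcm_erase hAB (d.hij 0).1 (d.hij 0).2 hb.1 hm.1) x hx
      have := aux_le_maxW w (Finset.mem_of_mem_erase hz)
      linarith

/-- strict lexicographic optimality -/
def AuxStrict (w : Sym2 V → ℝ) (E M : Finset (Sym2 V)) : Prop :=
  IsMCM E M ∧ ∀ N, IsMCM E N → N ≠ M → ∃ f ∈ N, f ∉ M ∧ ∀ e ∈ M, e ∉ N → w e < w f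

theorem aux_strict_of_pos {w : Sym2 V → ℝ} {E : Finset (Sym2 V)} : ∀ {n : ℕ} {A B : Finset V}
    (_ : Disjoint A B) (d : SeqBAPData w A B E n), IsMCM (induced E A B) d.img →
    (∀ k : Fin n, PosPrice w (induced E (d.Ak k) (d.Bk k)) s(d.i k, d.j k)) →
    AuxStrict w (induced E A B) d.img := by
  intro n
  induction n with
  | zero =>
    intro A B _ d h _
    refine ⟨h, fun N hN hne => absurd ?_ hne⟩
    have := aux_card_eq hN h
    have h0 : d.img = ∅ := by simp [SeqBAPData.img]
    rw [h0] at this ⊢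
    simpa using this
  | succ n ih =>
    intro A B hAB d h hp
    refine ⟨h, fun N hN hne => ?_⟩
    obtain ⟨hb, hm, -⟩ := d.first
    rw [aux_mem_maxEdges] at hm
    obtain ⟨hi1, hi2⟩ := d.img_tail hAB
    have he0 : s(d.i 0, d.j 0) ∈ d.img := by rw [hi1]; simp
    by_cases heN : s(d.i 0, d.j 0) ∈ N
    · have ht : IsMCM (induced E (A.erase (d.i 0)) (B.erase (d.j 0))) (d.tail hAB).img := by
        have := aux_mcm_erase hAB (d.hij 0).1 (d.hij 0).2 h he0
        rwa [hi1, Finset.erase_insert hi2] at this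
      have hs := ih (aux_disj_erase hAB _ _) (d.tail hAB) ht (fun k => hp k.succ)
      obtain ⟨f, hf, hf1, hf2⟩ := hs.2 _ (aux_mcm_erase hAB (d.hij 0).1 (d.hij 0).2 hN heN) (by
        intro h'
        apply hne
        rw [hi1, ← h', Finset.insert_erase heN])
      rw [Finset.mem_erase] at hf
      refine ⟨f, hf.2, ?_, ?_⟩
      · rw [hi1, Finset.mem_insert]
        rintro (h' | h')
        · exact hf.1 h'
        · exact hf1 h'
      · intro e he heN'
        rw [hi1, Finset.mem_insert] at he
        rcases he with rfl | he
        · exact absurd heN heN'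
        · exact hf2 e he (fun h' => heN' (Finset.mem_of_mem_erase h'))
    · have h0 := hp 0
      have h3 : d.Ak 0 = A := d.hA0 (by omega)
      have h4 : d.Bk 0 = B := d.hB0 (by omega)
      rw [h3, h4, aux_posPrice_iff] at h0
      have hlt : botW w (induced E A B) < maxW w N :=
        lt_of_le_of_ne (aux_botW_le w hN) (fun h' => heN (h0 N ⟨hN, h'.symm⟩))
      have hNe : N.Nonempty := by
        rw [← Finset.card_pos, aux_card_eq hN hb.1, Finset.card_pos]
        exact ⟨_, hm.1⟩
      obtain ⟨f, hf, hf'⟩ := aux_exists_maxW w hNe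
      have hall : ∀ x ∈ d.img, w x < w f := by
        intro x hx
        obtain ⟨y, hy, hxy⟩ := aux_weight_le hAB d _ hb.1 x hx
        have := aux_le_maxW w hy
        linarith [hb.2]
      exact ⟨f, hf, fun h' => lt_irrefl _ (hall f h'), fun e he _ => hall e he⟩

theorem aux_unique_of_strict {w : Sym2 V → ℝ} {E : Finset (Sym2 V)} : ∀ {n : ℕ} {A B : Finset V}
    (_ : Disjoint A B) (d : SeqBAPData w A B E n), IsMCM (induced E A B) d.img →
    ∀ M, AuxStrict w (induced E A B) M → d.img = M := by
  intro n
  induction n with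
  | zero =>
    intro A B _ d h M hM
    have := aux_card_eq hM.1 h
    have h0 : d.img = ∅ := by simp [SeqBAPData.img]
    rw [h0] at this ⊢
    exact (by simpa using this : M = ∅).symm
  | succ n ih =>
    intro A B hAB d h M hM
    obtain ⟨hb, hm, hpr⟩ := d.first
    rw [aux_mem_maxEdges] at hm
    obtain ⟨hi1, hi2⟩ := d.img_tail hAB
    have he0 : s(d.i 0, d.j 0) ∈ d.img := by rw [hi1]; simp
    have hMne : M.Nonempty := by
      rw [← Finset.card_pos, aux_card_eq hM.1 hb.1, Finset.card_pos]
      exact ⟨_, hm.1⟩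
    obtain ⟨t, ht, ht'⟩ := aux_exists_maxW w hMne
    have htN : ∀ N, IsBotAssignment w (induced E A B) N → t ∈ N := by
      intro N hN
      by_contra htN
      obtain ⟨f, hf, -, hf2⟩ := hM.2 N hN.1 (fun h' => htN (h' ▸ ht))
      have h1 := hf2 t ht htN
      have h2 := aux_le_maxW w hf
      have h3 := aux_botW_le w hM.1
      linarith [hN.2]
    have hMbot : IsBotAssignment w (induced E A B) M := by
      refine ⟨hM.1, le_antisymm ?_ (aux_botW_le w hM.1)⟩
      have := aux_le_maxW w (htN _ hb)
      rw [← ht', ← hb.2]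
      exact this
    have htp : PosPrice w (induced E A B) t := (aux_posPrice_iff _ _ _).2 htN
    have htm : t ∈ maxEdges w (d.Mk 0) :=
      aux_mem_maxEdges.2 ⟨htN _ hb, by rw [ht', hMbot.2, hb.2]⟩
    have h0p := (aux_price_pos_iff _ _ _).1
      (((aux_price_pos_iff _ _ _).2 htp).trans_le (hpr t htm))
    have he0M : s(d.i 0, d.j 0) ∈ M := (aux_posPrice_iff _ _ _).1 h0p M hMbot
    have h1 : (d.tail hAB).img = M.erase s(d.i 0, d.j 0) := by
      refine ih (aux_disj_erase hAB _ _) (d.tail hAB) ?_ _ ⟨?_, ?_⟩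
      · have := aux_mcm_erase hAB (d.hij 0).1 (d.hij 0).2 h he0
        rwa [hi1, Finset.erase_insert hi2] at this
      · exact aux_mcm_erase hAB (d.hij 0).1 (d.hij 0).2 hM.1 he0M
      · intro N hN hne
        have hnot := aux_notMem_del hAB (d.hij 0).1 (d.hij 0).2 hN.1
        obtain ⟨f, hf, hf1, hf2⟩ := hM.2 _
          (aux_mcm_insert hAB (d.hij 0).1 (d.hij 0).2 hM.1 he0M hN) (by
            intro h'
            apply hne
            rw [← h', Finset.erase_insert hnot])
        rw [Finset.mem_insert] at hf
        refine ⟨f, ?_, fun h' => hf1 (Finset.mem_of_mem_erase h'), ?_⟩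
        · rcases hf with rfl | hf
          · exact absurd he0M hf1
          · exact hf
        · intro e he heN
          rw [Finset.mem_erase] at he
          refine hf2 e he.2 ?_
          rw [Finset.mem_insert]
          rintro (h' | h')
          · exact he.1 h'
          · exact heN h'
    rw [hi1, h1, Finset.insert_erase he0M]

/-- completion avoiding a given edge -/
theorem aux_avoid {w : Sym2 V → ℝ} {E : Finset (Sym2 V)} (e : Sym2 V) :
    ∀ {n : ℕ} {A B : Finset V} (_ : Disjoint A B) (N : Finset (Sym2 V)),
    IsMCM (induced E A B) N → N.card = n → e ∉ N → (∀ x ∈ N, w x ≤ w e) →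
    ∃ d : SeqBAPData w A B E n, IsMCM (induced E A B) d.img ∧ e ∉ d.img := by
  intro n
  induction n with
  | zero =>
    intro A B _ N hN hc _ _
    rw [Finset.card_eq_zero] at hc
    subst hc
    refine ⟨⟨fun k => k.elim0, fun k => k.elim0, fun k => k.elim0, fun k => k.elim0,
      fun k => k.elim0, fun k => k.elim0, fun k => k.elim0, fun h => absurd h (by omega),
      fun h => absurd h (by omega), fun k h => absurd h (by omega),
      fun k h => absurd h (by omega), fun k => k.elim0, fun k => k.elim0, fun k => k.elim0⟩, ?_, ?_⟩
    · simpa [SeqBAPData.img] using hN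
    · simp [SeqBAPData.img]
  | succ n ih =>
    intro A B hAB N hN hc heN hle
    have hNne : N.Nonempty := by rw [← Finset.card_pos]; omega
    obtain ⟨N', hN', heN', hle'⟩ : ∃ N', IsBotAssignment w (induced E A B) N' ∧ e ∉ N' ∧
        ∀ x ∈ N', w x ≤ w e := by
      by_cases hb : maxW w N = botW w (induced E A B)
      · exact ⟨N, ⟨hN, hb⟩, heN, hle⟩
      · have hlt := lt_of_le_of_ne (aux_botW_le w hN) (Ne.symm hb)
        obtain ⟨t, ht, ht'⟩ := aux_exists_maxW w hNne
        obtain ⟨N', hN'⟩ := aux_exists_bot w (induced E A B)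
        have hall : ∀ x ∈ N', w x < w e := by
          intro x hx
          have := aux_le_maxW w hx
          have := hle t ht
          linarith [hN'.2]
        exact ⟨N', hN', fun h' => lt_irrefl _ (hall e h'), fun x hx => (hall x hx).le⟩
    have hc' : N'.card = n + 1 := by rw [aux_card_eq hN'.1 hN, hc]
    have hNne' : N'.Nonempty := by rw [← Finset.card_pos]; omega
    obtain ⟨t, ht, ht'⟩ := aux_exists_maxW w hNne'
    obtain ⟨f, hf, hfmax⟩ := Finset.exists_max_image (maxEdges w N') (price w (induced E A B))
      ⟨t, aux_mem_maxEdges.2 ⟨ht, ht'⟩⟩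
    have hfN := (aux_mem_maxEdges.1 hf).1
    have hfE := hN'.1.1 hfN
    unfold induced at hfE
    rw [Finset.mem_filter] at hfE
    obtain ⟨-, a, ha, b, hb, rfl⟩ := hfE
    have hm := aux_mcm_erase hAB ha hb hN'.1 hfN
    obtain ⟨d, hd, hed⟩ := ih (aux_disj_erase hAB a b) (N'.erase s(a, b)) hm
      (by rw [Finset.card_erase_of_mem hfN]; omega)
      (fun h' => heN' (Finset.mem_of_mem_erase h'))
      (fun x hx => hle' x (Finset.mem_of_mem_erase hx))
    refine ⟨SeqBAPData.cons hAB ha hb N' hN' hf hfmax d, ?_, ?_⟩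
    · rw [SeqBAPData.img_cons]
      exact aux_mcm_insert hAB ha hb hN'.1 hfN hd
    · rw [SeqBAPData.img_cons, Finset.mem_insert]
      rintro (rfl | h')
      · exact heN' hfN
      · exact hed h'

theorem aux_other {w : Sym2 V → ℝ} {E : Finset (Sym2 V)} :
    ∀ {n : ℕ} {A B : Finset V} (_ : Disjoint A B) (d : SeqBAPData w A B E n),
    IsMCM (induced E A B) d.img →
    ∀ k : Fin n, ¬ PosPrice w (induced E (d.Ak k) (d.Bk k)) s(d.i k, d.j k) →
    ∃ d' : SeqBAPData w A B E n, IsMCM (induced E A B) d'.img ∧ d'.img ≠ d.img := by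
  intro n
  induction n with
  | zero => intro A B _ d _ k; exact k.elim0
  | succ n ih =>
    intro A B hAB d hd k
    obtain ⟨hb, hm', hpr⟩ := d.first
    have hm := aux_mem_maxEdges.1 hm'
    obtain ⟨hi1, hi2⟩ := d.img_tail hAB
    have he0 : s(d.i 0, d.j 0) ∈ d.img := by rw [hi1]; simp
    refine Fin.cases ?_ (fun k => ?_) k
    · intro hp
      have h3 : d.Ak 0 = A := d.hA0 (by omega)
      have h4 : d.Bk 0 = B := d.hB0 (by omega)
      rw [h3, h4, aux_posPrice_iff] at hp
      push Not at hp
      obtain ⟨N, hN, heN⟩ := hp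
      have hc : d.img.card = n + 1 := by
        unfold SeqBAPData.img
        rw [Finset.card_image_of_injective _ (fun k l h => d.hedsitinct k l h)]
        simp
      obtain ⟨d', h1, h2⟩ := aux_avoid (w := w) s(d.i 0, d.j 0) hAB N hN.1
        ((aux_card_eq hN.1 hd).trans hc) heN (fun x hx => by
          have := aux_le_maxW w hx
          linarith [hm.2, hN.2, hb.2])
      exact ⟨d', h1, fun h' => h2 (h' ▸ he0)⟩
    · intro hp
      have ht : IsMCM (induced E (A.erase (d.i 0)) (B.erase (d.j 0))) (d.tail hAB).img := by
        have := aux_mcm_erase hAB (d.hij 0).1 (d.hij 0).2 hd he0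
        rwa [hi1, Finset.erase_insert hi2] at this
      obtain ⟨d', h1, h2⟩ := ih (aux_disj_erase hAB _ _) (d.tail hAB) ht k hp
      refine ⟨SeqBAPData.cons hAB (d.hij 0).1 (d.hij 0).2 (d.Mk 0) hb hm' hpr d', ?_, ?_⟩
      · rw [SeqBAPData.img_cons]
        exact aux_mcm_insert hAB (d.hij 0).1 (d.hij 0).2 hb.1 hm.1 h1
      · rw [SeqBAPData.img_cons, hi1]
        intro h'
        apply h2
        rw [← Finset.erase_insert (aux_notMem_del hAB (d.hij 0).1 (d.hij 0).2 h1.1), h',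
          Finset.erase_insert hi2]

/-- For a SeqBAP solution `M` with associated data (graphs `G^k` and selected
edges `{i_k, j_k}`), all sequentially selected edges have strictly positive price of
absence in their respective graphs `G^k` iff `M` is the unique solution to the SeqBAP. -/
theorem all_posPrice_iff_unique_seqBAP_sol
    (A B : Finset V) (E : Finset (Sym2 V)) (w : Sym2 V → ℝ)
    (hbip : IsBipartiteOn A B E)
    (M : Finset (Sym2 V)) (hMCM : IsMCM E M)
    (n : ℕ) (d : SeqBAPData w A B E n)
    (hcard : M.card = n)
    (hMeq : M = Finset.image (fun k => s(d.i k, d.j k)) Finset.univ) :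
    (∀ k : Fin n, PosPrice w (induced E (d.Ak k) (d.Bk k)) s(d.i k, d.j k)) ↔
      ∀ M' : Finset (Sym2 V), IsSeqBAPSol w A B E M' → M' = M := by
  have hE : induced E A B = E := by
    unfold induced
    exact Finset.filter_true_of_mem hbip.2
  have hAB := hbip.1
  have hM1 : M = d.img := hMeq
  have hMd : IsMCM (induced E A B) d.img := by rw [hE, ← hM1]; exact hMCM
  constructor
  · rintro hp M' ⟨h1, n', d', h2, h3⟩
    have h3' : M' = d'.img := h3
    rw [h3', hM1]
    refine aux_unique_of_strict hAB d' ?_ _ (aux_strict_of_pos hAB d hMd hp)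
    rw [hE, ← h3']
    exact h1
  · intro hu k
    by_contra hp
    obtain ⟨d', h1, h2⟩ := aux_other hAB d hMd k hp
    refine h2 ((hu d'.img ⟨(by rw [hE] at h1; exact h1), n, d', ?_, rfl⟩).trans hM1)
    rw [aux_card_eq h1 hMd, ← hM1, hcard]
end

section
/- Let G be a finite bipartite graph with weight function w and let M = {{i_1,j_1},...,{i_n,j_n}} be a solution to the SeqBAP for G, where {i_k,j_k} denotes the edge selected at step k. Then the selected edge weights are nonincreasing: w({i_k,j_k}) ≥ w({i_{k+1},j_{k+1}}) for all k ∈ {1,...,n−1}. -/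
open Finset

variable {V : Type*} [Fintype V] [DecidableEq V]

lemma aux_uniq {M : Finset (Sym2 V)} (hM : IsMatching M) {v : V} {e f : Sym2 V}
    (he : e ∈ M) (hf : f ∈ M) (hve : v ∈ e) (hvf : v ∈ f) : e = f :=
  Finset.card_le_one.1 (hM v) e (Finset.mem_filter.2 ⟨he, hve⟩) f (Finset.mem_filter.2 ⟨hf, hvf⟩)

lemma aux_sub (w : Sym2 V → ℝ) (A B : Finset V) (E : Finset (Sym2 V)) (n : ℕ)
    (d : SeqBAPData w A B E n) :
    ∀ (k : ℕ) (h : k < n), d.Ak ⟨k, h⟩ ⊆ A ∧ d.Bk ⟨k, h⟩ ⊆ B := by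
  intro k
  induction k with
  | zero => intro h; rw [d.hA0 h, d.hB0 h]; exact ⟨subset_rfl, subset_rfl⟩
  | succ k ih =>
    intro h
    rw [d.hAk k h, d.hBk k h]
    obtain ⟨h1, h2⟩ := ih (by omega)
    exact ⟨(Finset.erase_subset _ _).trans h1, (Finset.erase_subset _ _).trans h2⟩

lemma aux_step (w : Sym2 V → ℝ) (E : Finset (Sym2 V)) (A B : Finset V) (hd : Disjoint A B)
    (i j : V) (hi : i ∈ A) (hj : j ∈ B) (Ak Bk : Finset V) (hA : Ak ⊆ A) (hB : Bk ⊆ B)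
    (M M' : Finset (Sym2 V)) (hM : IsMCM (induced E Ak Bk) M)
    (he : s(i, j) ∈ maxEdges w M)
    (hM' : IsBotAssignment w (induced E (Ak.erase i) (Bk.erase j)) M')
    (f : Sym2 V) (hf : f ∈ M') : w f ≤ w s(i, j) := by
  obtain ⟨heM, hmax⟩ := Finset.mem_filter.1 he
  obtain ⟨hsub, hmat, hmx⟩ := hM
  obtain ⟨⟨hsub', hmat', hmx'⟩, hbot⟩ := hM'
  have hN : IsMCM (induced E (Ak.erase i) (Bk.erase j)) (M.erase s(i, j)) := by
    refine ⟨?_, ?_, ?_⟩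
    · intro g hg
      obtain ⟨hne, hgM⟩ := Finset.mem_erase.1 hg
      obtain ⟨hgE, a, ha, b, hb, rfl⟩ := Finset.mem_filter.1 (hsub hgM)
      refine Finset.mem_filter.2 ⟨hgE, a, Finset.mem_erase.2 ⟨?_, ha⟩,
        b, Finset.mem_erase.2 ⟨?_, hb⟩, rfl⟩
      · rintro rfl
        exact hne (aux_uniq hmat hgM heM (Sym2.mem_mk_left _ _) (Sym2.mem_mk_left _ _))
      · rintro rfl
        exact hne (aux_uniq hmat hgM heM (Sym2.mem_mk_right _ _) (Sym2.mem_mk_right _ _))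
    · intro v
      exact (Finset.card_le_card
        (Finset.filter_subset_filter _ (Finset.erase_subset _ _))).trans (hmat v)
    · intro X hX hXm
      have key : ∀ g ∈ X, i ∉ g ∧ j ∉ g := by
        intro g hg
        obtain ⟨_, a, ha, b, hb, rfl⟩ := Finset.mem_filter.1 (hX hg)
        rw [Finset.mem_erase] at ha hb
        have h1 : i ≠ b := fun h => Finset.disjoint_left.1 hd hi (h ▸ hB hb.2)
        have h2 : j ≠ a := fun h => Finset.disjoint_left.1 hd (hA ha.2) (h ▸ hj)
        simp only [Sym2.mem_iff]
        exact ⟨fun h => h.elim (fun h => ha.1 h.symm) h1,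
          fun h => h.elim h2 (fun h => hb.1 h.symm)⟩
      have hnot : s(i, j) ∉ X := fun h => (key _ h).1 (Sym2.mem_mk_left _ _)
      have hle := hmx (insert s(i, j) X) ?_ ?_
      · rw [Finset.card_insert_of_notMem hnot] at hle
        rw [Finset.card_erase_of_mem heM]
        omega
      · intro g hg
        rcases Finset.mem_insert.1 hg with rfl | hg
        · exact hsub heM
        · obtain ⟨hgE, a, ha, b, hb, rfl⟩ := Finset.mem_filter.1 (hX hg)
          exact Finset.mem_filter.2 ⟨hgE, a, Finset.mem_of_mem_erase ha,
            b, Finset.mem_of_mem_erase hb, rfl⟩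
      · intro v
        rw [Finset.card_le_one]
        intro x hx y hy
        obtain ⟨hx, hvx⟩ := Finset.mem_filter.1 hx
        obtain ⟨hy, hvy⟩ := Finset.mem_filter.1 hy
        have clash : ∀ g ∈ X, v ∈ g → v ∉ s(i, j) := by
          intro g hg hvg hv
          rcases Sym2.mem_iff.1 hv with rfl | rfl
          · exact (key g hg).1 hvg
          · exact (key g hg).2 hvg
        rcases Finset.mem_insert.1 hx with rfl | hx <;> rcases Finset.mem_insert.1 hy with rfl | hy
        · rfl
        · exact absurd hvx (clash y hy hvy)
        · exact absurd hvy (clash x hx hvx)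
        · exact aux_uniq hXm hx hy hvx hvy
  have hne : (M.erase s(i, j)).Nonempty := by
    rw [← Finset.card_pos]
    exact (Finset.card_pos.2 ⟨f, hf⟩).trans_le (hN.2.2 M' hsub' hmat')
  have h1 : w f ≤ maxW w M' :=
    le_csSup ((M'.finite_toSet.image w).bddAbove) ⟨f, hf, rfl⟩
  have h2 : botW w (induced E (Ak.erase i) (Bk.erase j)) ≤ maxW w (M.erase s(i, j)) :=
    csInf_le (((Set.toFinite _).image _).bddBelow) ⟨_, hN, rfl⟩
  have h3 : maxW w (M.erase s(i, j)) ≤ w s(i, j) := by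
    apply csSup_le
    · exact (Finset.coe_nonempty.2 hne).image w
    · rintro _ ⟨g, hg, rfl⟩
      exact hmax g (Finset.mem_of_mem_erase hg)
  linarith

/-- The weights of the edges selected by the SeqBAP are nonincreasing in the
selection order: `w({i_k, j_k}) ≥ w({i_{k+1}, j_{k+1}})`. -/
theorem seqBAP_selected_weights_nonincreasing
    (A B : Finset V) (E : Finset (Sym2 V)) (w : Sym2 V → ℝ)
    (hbip : IsBipartiteOn A B E)
    (M : Finset (Sym2 V)) (hMCM : IsMCM E M)
    (n : ℕ) (d : SeqBAPData w A B E n)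
    (hcard : M.card = n)
    (hMeq : M = Finset.image (fun k => s(d.i k, d.j k)) Finset.univ) :
    ∀ (k : ℕ) (h : k + 1 < n),
      w s(d.i ⟨k + 1, h⟩, d.j ⟨k + 1, h⟩) ≤
        w s(d.i ⟨k, by omega⟩, d.j ⟨k, by omega⟩) := by
  intro k h
  obtain ⟨hA, hB⟩ := aux_sub w A B E n d k (by omega)
  obtain ⟨hi, hj⟩ := d.hij ⟨k, by omega⟩
  have hM' := d.hMk ⟨k + 1, h⟩
  rw [d.hAk k h, d.hBk k h] at hM'
  exact aux_step w E A B hbip.1 _ _ hi hj _ _ hA hB _ _ (d.hMk ⟨k, by omega⟩).1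
    (d.hmaxedge ⟨k, by omega⟩) hM' _ (Finset.mem_filter.1 (d.hmaxedge ⟨k + 1, h⟩)).1
end
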